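/- Let $h\ge 2$ be an integer, let $a/b$ be an $h$-Farey fraction (a reduced fraction with $1\le b\le h$) and let $a'/b'$ be the preceding $h$-Farey fraction. Let $\Delta\subset\mathbb N$ be finite and nonempty and let $\tau,m$ be integers. Put $$c=\left\lfloor \frac{ahm}{b}\right\rfloor-m-\tau,\qquad \Gamma=\left\{\left\lfloor\frac{c+m-1}{h}\right\rfloor-\delta : \delta\in\Delta\right\},\qquad t=\frac{ahm}{b}-c-m,\qquad w=c+m-h\min\Gamma,$$ and let $S=\langle m,\Gamma\rangle_c$ be the additive monoid generated by $m$, the elements of $\Gamma$ and all integers $\ge c$. A nonzero element of $S$ is primitive if it is not the sum of two smaller nonzero elements of $S$; the primitive elements are the generators of $S$. Assume that * $m<\gamma$ for all $\gamma\in\Gamma$ (so that $m$ is the multiplicity of $S$); * $m\ge w$ (that is, the $h$-fold sumset $h\Gamma$ is contained in $[c,c+m)$); * $t\ge 0$ and $m>bb't/h$ (that is, $a'/b'<\frac{c+m}{hm}\le a/b$); * $S$ is canonically defined: $m$ and all elements of $\Gamma$ are primitive in $S$, and $c-1\notin S$; * $S$ is collision-free: every element of $S$ in $[c,c+m)$ can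 be written in only one way, up to reordering, as a sum of generators of $S$. Let $k$ be the number of elements of $S$ smaller than $c$, $\ell$ the number of primitive elements of $S$ smaller than $c$, and $r$ the number of primitive elements of $S$ in $[c,c+m)$; write $c=qm-\rho$ with $q=\lceil c/m\rceil$, $0\le\rho<m$; and let $E=k\ell+qr-c$ be the Eliahou number of $S$. Let $\omega=\sum_{i=0}^{h-1}\omega_i$, where $\omega_i$ is the number of long elements of the $i$-fold sumset $i\Gamma$ (with $0\Gamma=\{0\}$), that is, of the $\lambda\in i\Gamma$ with $\lceil (c-\lambda)/m\rceil=\lfloor (h-i)a'/b'\rfloor+1$. Write $\{x\}=x-\lfloor x\rfloor$, $\varphi_i=\{-ia/b\}$, $\varphi'_i=\{ia'/b'\}$, $s_i=\binom{\ell+i-2}{i}$ and $s=\binom{\ell+h-1}{h}$. Then $$E=E_0+\rho+\ell\omega,\qquad\text{where}\qquad E_0=-\ell\sum_{i=0}^{h-1}\varphi'_{h-i}s_i+\varphi'_h s .$$ Moreover $E_0$ has the equivalent forms $$E_0=-(h-1)s_h+\ell\sum_{i=0}^{h-1}\varphi_{h-i}s_i-\varphi_h s,$$ $$E_0=-\lfloor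 h\varphi'_1\rfloor s+\ell\sum_{j=1}^{\lfloor h\varphi'_1\rfloor}\binom{\ell+n'_j-1}{n'_j},\qquad n'_j=h-\lceil j/\varphi'_1\rceil,$$ $$E_0=-(h-1)s_h+\lfloor h\varphi_1\rfloor s-\ell\sum_{j=1}^{\lfloor h\varphi_1\rfloor}\binom{\ell+n_j-1}{n_j},\qquad n_j=h-\lceil j/\varphi_1\rceil .$$ -/

import Mathlib

/-- `a/b` is an `h`-Farey fraction: a reduced fraction with `1 ≤ b ≤ h`. -/
def IsFareyFrac (h : ℕ) (a b : ℤ) : Prop :=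
  0 < b ∧ b ≤ (h : ℤ) ∧ IsCoprime a b

/-- `a'/b'` is the `h`-Farey predecessor of `a/b`: both are `h`-Farey
fractions, `a'/b' < a/b`, and no `h`-Farey fraction lies strictly between
them (so they are consecutive `h`-Farey fractions). -/
def IsFareyPred (h : ℕ) (a b a' b' : ℤ) : Prop :=
  IsFareyFrac h a b ∧ IsFareyFrac h a' b' ∧
    (a' : ℚ) / (b' : ℚ) < (a : ℚ) / (b : ℚ) ∧
    ∀ p q : ℤ, IsFareyFrac h p q →
      (p : ℚ) / (q : ℚ) ≤ (a' : ℚ) / (b' : ℚ) ∨ (a : ℚ) / (b : ℚ) ≤ (p : ℚ) / (q : ℚ)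

namespace Eliahou

/-- An element `x` of `S` is primitive if it is a nonzero element of `S` that is
not the sum of two smaller nonzero elements of `S`. -/
def IsPrimitive (S : Set ℤ) (x : ℤ) : Prop :=
  x ∈ S ∧ x ≠ 0 ∧
    ¬ ∃ u v : ℤ, u ∈ S ∧ v ∈ S ∧ u ≠ 0 ∧ v ≠ 0 ∧ u < x ∧ v < x ∧ u + v = x

/-- The numerical semigroup `⟨m, Γ⟩_c`: the additive submonoid generated by `m`,
the elements of `Γ` and all integers `≥ c`. -/
def SgpSet (m : ℤ) (Γ : Finset ℤ) (c : ℤ) : Set ℤ :=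
  (AddSubmonoid.closure ({m} ∪ (Γ : Set ℤ) ∪ Set.Ici c) : Set ℤ)

/-- `k`, the rank: the number of elements of `S` smaller than `c`. -/
noncomputable def rank (S : Set ℤ) (c : ℤ) : ℕ := (S ∩ Set.Iio c).ncard

/-- `ℓ`, the number of left generators: primitive elements smaller than `c`. -/
noncomputable def nLeftGen (S : Set ℤ) (c : ℤ) : ℕ :=
  {x : ℤ | IsPrimitive S x ∧ x < c}.ncard

/-- `r`, the number of right generators: primitive elements in `[c, c+m)`. -/
noncomputable def nRightGen (S : Set ℤ) (c m : ℤ) : ℕ :=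
  {x : ℤ | IsPrimitive S x ∧ c ≤ x ∧ x < c + m}.ncard

/-- `q = ⌈c/m⌉`, the depth. -/
noncomputable def qdepth (c m : ℤ) : ℤ := ⌈(c : ℚ) / (m : ℚ)⌉

/-- `ρ = qm − c`. -/
noncomputable def rho (c m : ℤ) : ℤ := qdepth c m * m - c

/-- The Eliahou number `E = kℓ + qr − c`. -/
noncomputable def EliahouNum (S : Set ℤ) (c m : ℤ) : ℤ :=
  (rank S c : ℤ) * (nLeftGen S c : ℤ) + qdepth c m * (nRightGen S c m : ℤ) - c

/-- The `i`-fold sumset `iΓ` of a finite set `Γ` (with `0Γ = {0}`). -/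
def sumset (Γ : Finset ℤ) : ℕ → Set ℤ
  | 0 => {0}
  | i + 1 => {x : ℤ | ∃ g ∈ Γ, ∃ y ∈ sumset Γ i, x = g + y}

/-- `S` is collision-free: every element of `S` in `[c, c+m)` can be written in a
unique way (up to reordering, i.e. as a multiset) as a sum of generators
(primitive elements) of `S`. -/
def IsCollisionFree (S : Set ℤ) (c m : ℤ) : Prop :=
  ∀ x ∈ S, c ≤ x → x < c + m →
    ∀ M N : Multiset ℤ,
      (∀ g ∈ M, IsPrimitive S g) → (∀ g ∈ N, IsPrimitive S g) →
      M.sum = x → N.sum = x → M = N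

/-- The conductor `c = ⌊ahm/b⌋ − m − τ` of `S(h, a/b, Δ, τ, m)`. -/
noncomputable def Sc (h : ℕ) (a b τ m : ℤ) : ℤ :=
  ⌊(a : ℚ) * (h : ℚ) * (m : ℚ) / (b : ℚ)⌋ - m - τ

/-- The base point `⌊(c + m − 1)/h⌋`. -/
noncomputable def Sbase (h : ℕ) (a b τ m : ℤ) : ℤ :=
  ⌊((Sc h a b τ m + m - 1 : ℤ) : ℚ) / (h : ℚ)⌋

/-- `δ₁ = max Δ`. -/
def delta1 (Δ : Finset ℕ) : ℕ := Δ.sup id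

/-- `Γ = ⌊(c + m − 1)/h⌋ − Δ` (elementwise), the left generators other than `m`. -/
noncomputable def Sgam (h : ℕ) (a b τ m : ℤ) (Δ : Finset ℕ) : Finset ℤ :=
  Δ.image fun δ : ℕ => Sbase h a b τ m - (δ : ℤ)

/-- The semigroup `S(h, a/b, Δ, τ, m) = ⟨m, Γ⟩_c`. -/
noncomputable def Sset (h : ℕ) (a b τ m : ℤ) (Δ : Finset ℕ) : Set ℤ :=
  SgpSet m (Sgam h a b τ m Δ) (Sc h a b τ m)

/-- `t = ahm/b − c − m`. -/
noncomputable def St (h : ℕ) (a b τ m : ℤ) : ℚ :=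
  (a : ℚ) * (h : ℚ) * (m : ℚ) / (b : ℚ) - ((Sc h a b τ m : ℤ) : ℚ) - (m : ℚ)

/-- `γ₁ = min Γ = ⌊(c + m − 1)/h⌋ − δ₁`. -/
noncomputable def gamma1 (h : ℕ) (a b τ m : ℤ) (Δ : Finset ℕ) : ℤ :=
  Sbase h a b τ m - (delta1 Δ : ℤ)

/-- `w = c + m − hγ₁`. -/
noncomputable def Sw (h : ℕ) (a b τ m : ℤ) (Δ : Finset ℕ) : ℤ :=
  Sc h a b τ m + m - (h : ℤ) * gamma1 h a b τ m Δ

/-- `⌊(h − i) a'/b'⌋`, the lower bound for the number of left elements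
determined by `λ ∈ iΓ`. -/
noncomputable def shortBound (h : ℕ) (a' b' : ℤ) (i : ℕ) : ℤ :=
  ⌊((h : ℚ) - (i : ℚ)) * (a' : ℚ) / (b' : ℚ)⌋

/-- `⌈(c − λ)/m⌉`. -/
noncomputable def ceilCount (c m lam : ℤ) : ℤ := ⌈((c - lam : ℤ) : ℚ) / (m : ℚ)⌉

/-- `ω`, the number of long elements (elements `λ ∈ iΓ`, `i < h`, with
`⌈(c − λ)/m⌉ = ⌊(h − i) a'/b'⌋ + 1`). -/
noncomputable def nLong (h : ℕ) (a b a' b' τ m : ℤ) (Δ : Finset ℕ) : ℕ :=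
  ∑ i ∈ Finset.range h,
    {lam ∈ sumset (Sgam h a b τ m Δ) i |
      ceilCount (Sc h a b τ m) m lam = shortBound h a' b' i + 1}.ncard

/-- `S(h, a/b, Δ, τ, m)` is canonically defined: `m` and all elements of `Γ`
are primitive in `S` and `c − 1 ∉ S`. -/
def IsCanonical (h : ℕ) (a b τ m : ℤ) (Δ : Finset ℕ) : Prop :=
  IsPrimitive (Sset h a b τ m Δ) m ∧
    (∀ g ∈ Sgam h a b τ m Δ, IsPrimitive (Sset h a b τ m Δ) g) ∧
    Sc h a b τ m - 1 ∉ Sset h a b τ m Δ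

/-- `φ_i = frac(−ia/b)`. -/
noncomputable def phi (a b : ℤ) (i : ℕ) : ℚ :=
  Int.fract (-((i : ℚ) * (a : ℚ)) / (b : ℚ))

/-- `φ'_i = frac(ia'/b')`. -/
noncomputable def phi' (a' b' : ℤ) (i : ℕ) : ℚ :=
  Int.fract ((i : ℚ) * (a' : ℚ) / (b' : ℚ))

/-- The multiplicity of `S(h, a/b, Δ, τ, m) = ⟨m, Γ⟩_c` is `m`: the generator `m` is
strictly smaller than every element of `Γ`. (When `h ≥ 2` and `w ≤ m`, this forces
`0 < m < γ < c` for all `γ ∈ Γ`.) -/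
def IsMultiplicity (h : ℕ) (a b τ m : ℤ) (Δ : Finset ℕ) : Prop :=
  ∀ g ∈ Sgam h a b τ m Δ, m < g

/-- `s_i = C(ℓ + i − 2, i)`, the number of multisets of size `i` from `ℓ − 1`
elements. -/
def sNum (l i : ℕ) : ℕ := (l + i - 2).choose i

/-- `C(ℓ + n − 1, n)`, the number of multisets of size `n` from `ℓ` elements; for
`n = h` this is `s`. -/
def sTot (l n : ℕ) : ℕ := (l + n - 1).choose n

/-- `E₀ = −ℓ Σ_{i=0}^{h−1} φ'_{h−i} s_i + φ'_h s`. -/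
noncomputable def E0 (h : ℕ) (a' b' : ℤ) (l : ℕ) : ℚ :=
  -(l : ℚ) * ∑ i ∈ Finset.range h, phi' a' b' (h - i) * (sNum l i : ℚ)
    + phi' a' b' h * (sTot l h : ℚ)

/-- `−(h−1)s_h + ℓ Σ_{i=0}^{h−1} φ_{h−i} s_i − φ_h s`. -/
noncomputable def E0phi (h : ℕ) (a b : ℤ) (l : ℕ) : ℚ :=
  -((h : ℚ) - 1) * (sNum l h : ℚ)
    + (l : ℚ) * ∑ i ∈ Finset.range h, phi a b (h - i) * (sNum l i : ℚ)
    - phi a b h * (sTot l h : ℚ)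

/-- `Σ_{j=1}^{⌊hx⌋} C(ℓ + n_j − 1, n_j)` with `n_j = h − ⌈j/x⌉`, for `0 ≤ x < 1`.
Every summand has `x > 0` and `1 ≤ ⌈j/x⌉ ≤ h`, so nothing is truncated. -/
noncomputable def jumpSum (h : ℕ) (x : ℚ) (l : ℕ) : ℕ :=
  ∑ j ∈ Finset.Icc 1 ⌊(h : ℚ) * x⌋₊, sTot l (h - ⌈(j : ℚ) / x⌉₊)

/-- `−⌊hφ'_1⌋ s + ℓ Σ_{j=1}^{⌊hφ'_1⌋} C(ℓ + n_j − 1, n_j)`, `n_j = h − ⌈j/φ'_1⌉`. -/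
noncomputable def E0jump' (h : ℕ) (a' b' : ℤ) (l : ℕ) : ℚ :=
  -(⌊(h : ℚ) * phi' a' b' 1⌋ : ℚ) * (sTot l h : ℚ)
    + (l : ℚ) * (jumpSum h (phi' a' b' 1) l : ℚ)

/-- `−(h−1)s_h + ⌊hφ_1⌋ s − ℓ Σ_{j=1}^{⌊hφ_1⌋} C(ℓ + n_j − 1, n_j)`,
`n_j = h − ⌈j/φ_1⌉`. -/
noncomputable def E0jump (h : ℕ) (a b : ℤ) (l : ℕ) : ℚ :=
  -((h : ℚ) - 1) * (sNum l h : ℚ)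
    + (⌊(h : ℚ) * phi a b 1⌋ : ℚ) * (sTot l h : ℚ)
    - (l : ℚ) * (jumpSum h (phi a b 1) l : ℚ)

end Eliahou

open Eliahou

/-! ### Binomial identities -/

namespace Eliahou

lemma sum_range_choose_add (n h : ℕ) :
    ∑ i ∈ Finset.range (h + 1), (n + i).choose i = (n + 1 + h).choose h := by
  induction h with
  | zero => simp
  | succ h ih =>
    rw [Finset.sum_range_succ, ih, show n + 1 + (h + 1) = (n + 1 + h) + 1 by ring,
      Nat.choose_succ_succ, show n + (h + 1) = n + 1 + h by ring]

/-- `Σ_{i ≤ h} s_i = s`. -/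
lemma sum_sNum {l : ℕ} (hl : 2 ≤ l) (h : ℕ) :
    ∑ i ∈ Finset.range (h + 1), sNum l i = sTot l h := by
  obtain ⟨n, rfl⟩ := Nat.exists_eq_add_of_le' hl
  simp only [sNum, sTot]
  rw [show n + 2 + h - 1 = n + 1 + h by omega, ← sum_range_choose_add]
  refine Finset.sum_congr rfl fun i _ => ?_
  rw [show n + 2 + i - 2 = n + i by omega]

lemma add_mul_sTot {l : ℕ} (hl : 2 ≤ l) (h : ℕ) :
    (l + h) * sTot l h = (h + 1) * sTot l (h + 1) := by
  obtain ⟨n, rfl⟩ := Nat.exists_eq_add_of_le' hl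
  have := Nat.add_one_mul_choose_eq (n + 1 + h) h
  simp only [sTot]
  rw [show n + 2 + h - 1 = n + 1 + h by omega, show n + 2 + (h + 1) - 1 = n + 1 + h + 1 by omega,
    show n + 2 + h = n + 1 + h + 1 by omega, this, mul_comm]

lemma sub_one_mul_sTot {l : ℕ} (hl : 2 ≤ l) (h : ℕ) :
    ((l : ℚ) - 1) * sTot l h = ((l : ℚ) + h - 1) * sNum l h := by
  obtain ⟨n, rfl⟩ := Nat.exists_eq_add_of_le' hl
  have := Nat.add_one_mul_choose_eq (n + h) n
  have h1 : (n + h + 1).choose (n + 1) = (n + h + 1).choose h :=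
    Nat.choose_symm_of_eq_add (by ring)
  have h2 : (n + h).choose n = (n + h).choose h := Nat.choose_symm_of_eq_add (by ring)
  rw [h1, h2] at this
  simp only [sTot, sNum]
  rw [show n + 2 + h - 1 = n + h + 1 by omega, show n + 2 + h - 2 = n + h by omega]
  have := congrArg (Nat.cast : ℕ → ℚ) this
  push_cast at this ⊢
  linarith

lemma sum_sub_mul_sNum_succ {l : ℕ} (hl : 2 ≤ l) (h : ℕ) :
    ∑ i ∈ Finset.range (h + 1), (((h + 1 : ℕ) : ℚ) - i) * sNum l i
      = ∑ i ∈ Finset.range h, ((h : ℚ) - i) * sNum l i + sTot l h := by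
  rw [← sum_sNum hl h, Nat.cast_sum]
  have : ∑ i ∈ Finset.range h, ((h : ℚ) - i) * sNum l i
      = ∑ i ∈ Finset.range (h + 1), ((h : ℚ) - i) * sNum l i := by
    rw [Finset.sum_range_succ]; simp
  rw [this, ← Finset.sum_add_distrib]
  refine Finset.sum_congr rfl fun i _ => ?_
  push_cast; ring

/-- `ℓ Σ_{i < h} (h - i) s_i = h s`. -/
lemma mul_sum_sub_mul_sNum {l : ℕ} (hl : 2 ≤ l) (h : ℕ) :
    (l : ℚ) * ∑ i ∈ Finset.range h, ((h : ℚ) - i) * sNum l i = h * sTot l h := by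
  induction h with
  | zero => simp
  | succ h ih =>
    rw [sum_sub_mul_sNum_succ hl, mul_add, ih]
    have := congrArg (Nat.cast : ℕ → ℚ) (add_mul_sTot hl h)
    push_cast at this ⊢
    linarith

/-- A function linear in `i` contributes nothing to `ℓ Σ_{i < h} f_{h-i} s_i - f_h s`. -/
lemma mul_sum_linear_mul_sNum {l : ℕ} (hl : 2 ≤ l) (h : ℕ) (y : ℚ) :
    (l : ℚ) * ∑ i ∈ Finset.range h, (((h - i : ℕ) : ℚ) * y) * sNum l i
      = h * y * sTot l h := by
  have := mul_sum_sub_mul_sNum hl h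
  have h2 : ∑ i ∈ Finset.range h, (((h - i : ℕ) : ℚ) * y) * sNum l i
      = y * ∑ i ∈ Finset.range h, ((h : ℚ) - i) * sNum l i := by
    rw [Finset.mul_sum]
    refine Finset.sum_congr rfl fun i hi => ?_
    rw [Nat.cast_sub (Finset.mem_range.1 hi).le]; ring
  rw [h2]
  linear_combination y * this

lemma mul_sum_fract_mul_sNum {l : ℕ} (hl : 2 ≤ l) (h : ℕ) (y : ℚ) :
    (l : ℚ) * ∑ i ∈ Finset.range h, Int.fract (((h - i : ℕ) : ℚ) * y) * sNum l i
        - Int.fract ((h : ℚ) * y) * sTot l h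
      = ⌊(h : ℚ) * y⌋ * sTot l h
        - l * ∑ i ∈ Finset.range h, (⌊((h - i : ℕ) : ℚ) * y⌋ : ℚ) * sNum l i := by
  have := mul_sum_linear_mul_sNum hl h y
  simp only [← Int.self_sub_floor, sub_mul, Finset.sum_sub_distrib, mul_sub]
  linarith

/-! ### Counting by jumps -/

lemma sum_floor_mul_sNum {l : ℕ} (hl : 2 ≤ l) (h : ℕ) {x : ℚ} (hx : 0 ≤ x) :
    ∑ i ∈ Finset.range h, ⌊((h - i : ℕ) : ℚ) * x⌋₊ * sNum l i = jumpSum h x l := by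
  have hfloor : ∀ i ∈ Finset.range h, ⌊((h - i : ℕ) : ℚ) * x⌋₊ * sNum l i
      = ∑ j ∈ Finset.Icc 1 ⌊(h : ℚ) * x⌋₊,
          if (j : ℚ) ≤ ((h - i : ℕ) : ℚ) * x then sNum l i else 0 := by
    intro i _
    rw [← Finset.sum_filter, Finset.sum_const, smul_eq_mul]
    congr 1
    have : (Finset.Icc 1 ⌊(h : ℚ) * x⌋₊).filter (fun j : ℕ => (j : ℚ) ≤ ((h - i : ℕ) : ℚ) * x)
        = Finset.Icc 1 ⌊((h - i : ℕ) : ℚ) * x⌋₊ := by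
      ext j
      have h0 : 0 ≤ ((h - i : ℕ) : ℚ) * x := by positivity
      have hle : ⌊((h - i : ℕ) : ℚ) * x⌋₊ ≤ ⌊(h : ℚ) * x⌋₊ := by
        refine Nat.floor_le_floor (mul_le_mul_of_nonneg_right ?_ hx)
        exact_mod_cast Nat.sub_le h i
      simp only [Finset.mem_filter, Finset.mem_Icc, ← Nat.le_floor_iff h0]
      omega
    rw [this]; simp
  rw [Finset.sum_congr rfl hfloor, Finset.sum_comm, jumpSum]
  refine Finset.sum_congr rfl fun j hj => ?_
  obtain ⟨hj1, hj2⟩ := Finset.mem_Icc.1 hj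
  have hjx : (j : ℚ) ≤ h * x := (Nat.le_floor_iff (by positivity)).1 hj2
  have hj0 : (0 : ℚ) < j := by exact_mod_cast hj1
  have hx0 : 0 < x := by
    rcases hx.eq_or_lt with rfl | h0
    · simp at hjx; omega
    · exact h0
  have hc1 : 1 ≤ ⌈(j : ℚ) / x⌉₊ := Nat.ceil_pos.2 (by positivity)
  have hc2 : ⌈(j : ℚ) / x⌉₊ ≤ h := Nat.ceil_le.2 ((div_le_iff₀ hx0).2 hjx)
  rw [← Finset.sum_filter, ← sum_sNum hl]
  refine Finset.sum_congr ?_ fun _ _ => rfl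
  ext i
  rw [Finset.mem_filter, Finset.mem_range, Finset.mem_range, ← div_le_iff₀ hx0, ← Nat.ceil_le]
  omega

lemma sum_intFloor_mul_sNum {l : ℕ} (hl : 2 ≤ l) (h : ℕ) {x : ℚ} (hx : 0 ≤ x) :
    ∑ i ∈ Finset.range h, (⌊((h - i : ℕ) : ℚ) * x⌋ : ℚ) * sNum l i = jumpSum h x l := by
  rw [← sum_floor_mul_sNum hl h hx, Nat.cast_sum]
  refine Finset.sum_congr rfl fun i _ => ?_
  rw [Nat.cast_mul, ← natCast_floor_eq_intCast_floor (by positivity)]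

lemma fract_natCast_mul_fract (i : ℕ) (y : ℚ) :
    Int.fract ((i : ℚ) * Int.fract y) = Int.fract ((i : ℚ) * y) := by
  have : (i : ℚ) * y = i * Int.fract y + ((i * ⌊y⌋ : ℤ) : ℚ) := by
    push_cast
    rw [← mul_add, Int.fract_add_floor]
  rw [this, Int.fract_add_intCast]

lemma mul_sum_fract_eq_jump {l : ℕ} (hl : 2 ≤ l) (h : ℕ) (y : ℚ) :
    (l : ℚ) * ∑ i ∈ Finset.range h, Int.fract (((h - i : ℕ) : ℚ) * y) * sNum l i
        - Int.fract ((h : ℚ) * y) * sTot l h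
      = ⌊(h : ℚ) * Int.fract y⌋ * sTot l h - l * jumpSum h (Int.fract y) l := by
  rw [← sum_intFloor_mul_sNum hl h (Int.fract_nonneg y), ← mul_sum_fract_mul_sNum hl]
  simp only [fract_natCast_mul_fract]

/-! ### Farey neighbours -/

/-- No fraction with denominator `i ≤ h` lies strictly between consecutive `h`-Farey fractions,
so an `h`-Farey interval `(a'/b', a/b]` scaled by `i` contains at most one integer, its maximum. -/
lemma ceil_mul_eq_floor_add_one {h : ℕ} {a b a' b' : ℤ} (hF : IsFareyPred h a b a' b')
    {θ : ℚ} (h1 : (a' : ℚ) / b' < θ) (h2 : θ ≤ (a : ℚ) / b) {i : ℕ} (hi : 1 ≤ i) (hih : i ≤ h) :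
    ⌈(i : ℚ) * θ⌉ = ⌊(i : ℚ) * a' / b'⌋ + 1 := by
  have hi0 : (0 : ℚ) < i := by exact_mod_cast hi
  apply le_antisymm
  · set p : ℤ := ⌊(i : ℚ) * a' / b'⌋ + 1 with hp
    have hlt : (i : ℚ) * a' / b' < p := by rw [hp]; push_cast; exact Int.lt_floor_add_one _
    have hlt' : (a' : ℚ) / b' < (p : ℚ) / i := by
      rw [lt_div_iff₀ hi0]; calc
        _ = (i : ℚ) * a' / b' := by ring
        _ < p := hlt
    set x : ℚ := (p : ℚ) / i with hx
    have hden : (x.den : ℤ) ∣ (i : ℤ) := by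
      have := Rat.den_dvd p i
      rw [Rat.divInt_eq_div] at this
      simpa [hx] using this
    have hden' : (x.den : ℤ) ≤ h :=
      (Int.le_of_dvd (by exact_mod_cast hi) hden).trans (by exact_mod_cast hih)
    have hfar : IsFareyFrac h x.num x.den :=
      ⟨by exact_mod_cast x.den_pos, hden', Int.isCoprime_iff_gcd_eq_one.2 (by
        simpa [Int.gcd] using x.reduced)⟩
    have hxe : ((x.num : ℤ) : ℚ) / ((x.den : ℤ) : ℚ) = x := by
      rw [Int.cast_natCast]; exact Rat.num_div_den x
    rcases hF.2.2.2 _ _ hfar with h3 | h3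
    · rw [hxe] at h3; exact absurd h3 (not_le.2 hlt')
    · rw [hxe] at h3
      refine Int.ceil_le.2 ?_
      have := h2.trans h3
      rw [hx, le_div_iff₀ hi0] at this
      linarith
  · have : (⌊(i : ℚ) * a' / b'⌋ : ℚ) < ⌈(i : ℚ) * θ⌉ := calc
      _ ≤ (i : ℚ) * a' / b' := Int.floor_le _
      _ = i * (a' / b') := by ring
      _ < i * θ := mul_lt_mul_of_pos_left h1 hi0
      _ ≤ _ := Int.le_ceil _
    exact_mod_cast this

lemma phi'_add_phi {h : ℕ} {a b a' b' : ℤ} (hF : IsFareyPred h a b a' b') {i : ℕ}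
    (hi : 1 ≤ i) (hih : i ≤ h) :
    phi' a' b' i + phi a b i = 1 - i * ((a : ℚ) / b - a' / b') := by
  have := congrArg (Int.cast : ℤ → ℚ) (ceil_mul_eq_floor_add_one hF hF.2.2.1 le_rfl hi hih)
  rw [phi', phi, ← Int.self_sub_floor, ← Int.self_sub_floor,
    show -((i : ℚ) * a) / b = -(i * (a / b)) by ring, Int.floor_neg]
  push_cast at this ⊢
  rw [this]; ring

/-! ### Equivalent forms of `E₀` -/

variable {l : ℕ}

lemma phi'_eq (a' b' : ℤ) (i : ℕ) : phi' a' b' i = Int.fract ((i : ℚ) * (a' / b')) := by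
  rw [phi']; congr 1; ring

lemma phi_eq (a b : ℤ) (i : ℕ) : phi a b i = Int.fract ((i : ℚ) * (-(a / b))) := by
  rw [phi]; congr 1; ring

lemma E0_eq_floor (hl : 2 ≤ l) (h : ℕ) (a' b' : ℤ) :
    E0 h a' b' l = l * ∑ i ∈ Finset.range h, (⌊((h - i : ℕ) : ℚ) * (a' / b')⌋ : ℚ) * sNum l i
      - ⌊(h : ℚ) * (a' / b')⌋ * sTot l h := by
  have := mul_sum_fract_mul_sNum hl h ((a' : ℚ) / b')
  simp only [E0, phi'_eq]
  linarith

lemma E0_eq_E0jump' (hl : 2 ≤ l) (h : ℕ) (a' b' : ℤ) : E0 h a' b' l = E0jump' h a' b' l := by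
  have := mul_sum_fract_eq_jump hl h ((a' : ℚ) / b')
  simp only [E0, E0jump', phi'_eq, Nat.cast_one, one_mul]
  linarith

lemma E0phi_eq_E0jump (hl : 2 ≤ l) (h : ℕ) (a b : ℤ) : E0phi h a b l = E0jump h a b l := by
  have := mul_sum_fract_eq_jump hl h (-((a : ℚ) / b))
  simp only [E0phi, E0jump, phi_eq, Nat.cast_one, one_mul]
  linarith

lemma E0_eq_E0phi (hl : 2 ≤ l) {h : ℕ} (hh : 1 ≤ h) {a b a' b' : ℤ}
    (hF : IsFareyPred h a b a' b') : E0 h a' b' l = E0phi h a b l := by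
  set ε : ℚ := (a : ℚ) / b - a' / b' with hε
  have hsum : ∑ i ∈ Finset.range h, phi' a' b' (h - i) * (sNum l i : ℚ)
      = ∑ i ∈ Finset.range h, (sNum l i : ℚ)
        - ∑ i ∈ Finset.range h, (((h - i : ℕ) : ℚ) * ε) * sNum l i
        - ∑ i ∈ Finset.range h, phi a b (h - i) * (sNum l i : ℚ) := by
    rw [← Finset.sum_sub_distrib, ← Finset.sum_sub_distrib]
    refine Finset.sum_congr rfl fun i hi => ?_
    have hi' := Finset.mem_range.1 hi
    have := phi'_add_phi hF (i := h - i) (by omega) (by omega)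
    linear_combination (sNum l i : ℚ) * this
  have hh' := phi'_add_phi hF hh le_rfl
  have hlin := mul_sum_linear_mul_sNum hl h ε
  have htot := congrArg (Nat.cast : ℕ → ℚ) (sum_sNum hl h)
  rw [Nat.cast_sum, Finset.sum_range_succ] at htot
  have hlast := sub_one_mul_sTot hl h
  rw [E0, E0phi, hsum]
  linear_combination hlin + (sTot l h : ℚ) * hh' - l * htot - hlast

end Eliahou

namespace Eliahou

/-! ### Sumsets and multisets -/

lemma mem_sumset_iff {Γ : Finset ℤ} {i : ℕ} {x : ℤ} :
    x ∈ sumset Γ i ↔ ∃ M : Multiset ℤ, M.card = i ∧ (∀ g ∈ M, g ∈ Γ) ∧ M.sum = x := by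
  induction i generalizing x with
  | zero =>
    simp only [sumset, Set.mem_singleton_iff, Multiset.card_eq_zero]
    constructor
    · rintro rfl; exact ⟨0, by simp⟩
    · rintro ⟨M, rfl, -, rfl⟩; simp
  | succ i ih =>
    constructor
    · rintro ⟨g, hg, y, hy, rfl⟩
      obtain ⟨M, hM, hMΓ, rfl⟩ := ih.1 hy
      refine ⟨g ::ₘ M, by simp [hM], fun x hx => ?_, by simp⟩
      rcases Multiset.mem_cons.1 hx with rfl | hx
      exacts [hg, hMΓ _ hx]
    · rintro ⟨M, hM, hMΓ, rfl⟩
      obtain ⟨g, N, rfl⟩ := Multiset.card_pos_iff_exists_mem.1 (by omega : 0 < M.card) |>.imp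
        fun g hg => Multiset.exists_cons_of_mem hg
      refine ⟨g, hMΓ g (by simp), N.sum, ih.2 ⟨N, by simpa using hM, fun x hx => hMΓ x ?_, rfl⟩,
        by simp⟩
      exact Multiset.mem_cons_of_mem hx

lemma card_sym_eq_multichoose {α : Type*} [DecidableEq α] (s : Finset α) (i : ℕ) :
    (s.sym i).card = s.card.multichoose i := by
  have : s.sym i = (Finset.univ : Finset (Sym s i)).image (Sym.map Subtype.val) := by
    ext M
    simp only [Finset.mem_sym_iff, Finset.mem_image, Finset.mem_univ, true_and]
    constructor
    · intro hM
      refine ⟨M.attach.map fun x => ⟨x.1, hM x.1 x.2⟩, ?_⟩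
      rw [Sym.map_map]
      exact Sym.attach_map_coe M
    · rintro ⟨N, rfl⟩ x hx
      obtain ⟨y, -, rfl⟩ := Sym.mem_map.1 hx
      exact y.2
  rw [this, Finset.card_image_of_injective _ (Sym.map_injective Subtype.val_injective i),
    Finset.card_univ, Sym.card_sym_eq_multichoose, Fintype.card_coe]

/-- The `i`-fold sumset as a finite set. -/
def sumFinset (Γ : Finset ℤ) (i : ℕ) : Finset ℤ :=
  (Γ.sym i).image fun M : Sym ℤ i => (M : Multiset ℤ).sum

lemma mem_sumFinset {Γ : Finset ℤ} {i : ℕ} {x : ℤ} :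
    x ∈ sumFinset Γ i ↔ x ∈ sumset Γ i := by
  rw [mem_sumset_iff, sumFinset, Finset.mem_image]
  constructor
  · rintro ⟨M, hM, rfl⟩
    exact ⟨M, M.2, fun g hg => Finset.mem_sym_iff.1 hM g hg, rfl⟩
  · rintro ⟨M, hM, hMΓ, rfl⟩
    exact ⟨⟨M, hM⟩, Finset.mem_sym_iff.2 hMΓ, rfl⟩

lemma add_mem_sumset {Γ : Finset ℤ} {i j : ℕ} {x y : ℤ} (hx : x ∈ sumset Γ i)
    (hy : y ∈ sumset Γ j) : x + y ∈ sumset Γ (i + j) := by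
  rw [mem_sumset_iff] at *
  obtain ⟨M, rfl, hM, rfl⟩ := hx
  obtain ⟨N, rfl, hN, rfl⟩ := hy
  refine ⟨M + N, by simp, fun g hg => ?_, by simp⟩
  rcases Multiset.mem_add.1 hg with hg | hg
  exacts [hM g hg, hN g hg]

lemma sumset_one_of_mem {Γ : Finset ℤ} {g : ℤ} (hg : g ∈ Γ) : g ∈ sumset Γ 1 :=
  ⟨g, hg, 0, rfl, by simp⟩

lemma sumset_bounds {Γ : Finset ℤ} {u v d : ℤ} (hlo : ∀ g ∈ Γ, u ≤ d * g)
    (hhi : ∀ g ∈ Γ, d * g ≤ v) {i : ℕ} {x : ℤ} (hx : x ∈ sumset Γ i) :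
    i * u ≤ d * x ∧ d * x ≤ i * v := by
  induction i generalizing x with
  | zero => simp [sumset] at hx; simp [hx]
  | succ i ih =>
    obtain ⟨g, hg, y, hy, rfl⟩ := hx
    obtain ⟨h1, h2⟩ := ih hy
    have := hlo g hg
    have := hhi g hg
    push_cast
    constructor <;> linarith

/-! ### Regular semigroups -/

lemma mult_mem_SgpSet (m c : ℤ) (Γ : Finset ℤ) : m ∈ SgpSet m Γ c :=
  AddSubmonoid.subset_closure (Or.inl (Or.inl rfl))

lemma gen_mem_SgpSet (m c : ℤ) {Γ : Finset ℤ} {g : ℤ} (hg : g ∈ Γ) : g ∈ SgpSet m Γ c :=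
  AddSubmonoid.subset_closure (Or.inl (Or.inr hg))

/-- The pair `(m, Γ)` generates, up to `c`, an `h`-regular semigroup of multiplicity `m`. -/
structure IsRegularData (h : ℕ) (c m : ℤ) (Γ : Finset ℤ) : Prop where
  two_le : 2 ≤ h
  nonempty : Γ.Nonempty
  pos : 0 < m
  lt_of_mem : ∀ g ∈ Γ, m < g
  le_mul : ∀ g ∈ Γ, c ≤ h * g
  mul_le : ∀ g ∈ Γ, h * g ≤ c + m - 1

namespace IsRegularData

variable {h : ℕ} {c m : ℤ} {Γ : Finset ℤ}

lemma mul_add_one_le (H : IsRegularData h c m Γ) : (h : ℤ) * (m + 1) ≤ c + m - 1 := by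
  obtain ⟨g, hg⟩ := H.nonempty
  exact (mul_le_mul_of_nonneg_left (H.lt_of_mem g hg) (by positivity)).trans (H.mul_le g hg)

lemma lt_conductor (H : IsRegularData h c m Γ) : m < c := by
  have := H.mul_add_one_le
  have h2 : (2 : ℤ) ≤ h := by exact_mod_cast H.two_le
  nlinarith [H.pos]

lemma sumset_nonneg (H : IsRegularData h c m Γ) {i : ℕ} {x : ℤ} (hx : x ∈ sumset Γ i) : 0 ≤ x := by
  obtain ⟨M, -, hM, rfl⟩ := mem_sumset_iff.1 hx
  exact Multiset.sum_nonneg fun g hg => (H.pos.trans (H.lt_of_mem g (hM g hg))).le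

lemma cast_pos (H : IsRegularData h c m Γ) : (0 : ℤ) < h := by have := H.two_le; omega

lemma sumset_lt_conductor (H : IsRegularData h c m Γ) {i : ℕ} (hi : i < h) {x : ℤ} (hx : x ∈ sumset Γ i) : x < c := by
  have h1 := (sumset_bounds H.le_mul H.mul_le hx).2
  have h2 := H.mul_add_one_le
  have h3 := H.lt_conductor
  have h4 := H.pos
  have h5 : (i : ℤ) + 1 ≤ h := by exact_mod_cast hi
  have h6 := H.cast_pos
  have h7 : (i : ℤ) * (c + m - 1) ≤ (h - 1) * (c + m - 1) :=
    mul_le_mul_of_nonneg_right (by linarith) (by linarith)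
  have : (h : ℤ) * x < h * c := by nlinarith
  exact lt_of_mul_lt_mul_left this h6.le

lemma conductor_le_sumset (H : IsRegularData h c m Γ) {i : ℕ} (hi : h ≤ i) {x : ℤ} (hx : x ∈ sumset Γ i) : c ≤ x := by
  have h1 := (sumset_bounds H.le_mul H.mul_le hx).1
  have h3 := H.lt_conductor
  have h4 := H.pos
  have h5 : (h : ℤ) ≤ i := by exact_mod_cast hi
  have : (h : ℤ) * c ≤ h * x := le_trans (mul_le_mul_of_nonneg_right h5 (by linarith)) h1
  exact le_of_mul_le_mul_left this H.cast_pos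

lemma sumset_lt_conductor_add (H : IsRegularData h c m Γ) {x : ℤ} (hx : x ∈ sumset Γ h) : x < c + m := by
  have h1 := (sumset_bounds H.le_mul H.mul_le hx).2
  have := le_of_mul_le_mul_left h1 H.cast_pos
  linarith

lemma conductor_add_lt_sumset (H : IsRegularData h c m Γ) {i : ℕ} (hi : h < i) {x : ℤ} (hx : x ∈ sumset Γ i) :
    c + m < x := by
  obtain ⟨j, rfl⟩ := Nat.exists_eq_add_of_lt hi
  obtain ⟨g, hg, y, hy, rfl⟩ := hx
  have := H.conductor_le_sumset (by omega) hy
  have := H.lt_of_mem g hg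
  linarith

/-- The elements of `⟨m, Γ⟩_c` are those `≥ c` and the `λ + jm` with `λ ∈ iΓ`. -/
lemma mem_SgpSet_iff (H : IsRegularData h c m Γ) {x : ℤ} :
    x ∈ SgpSet m Γ c ↔ c ≤ x ∨ ∃ i j : ℕ, ∃ y ∈ sumset Γ i, x = y + j * m := by
  have hm := H.pos
  have hc := H.lt_conductor
  constructor
  · intro hx
    have hnn : ∀ z, (c ≤ z ∨ ∃ i j : ℕ, ∃ y ∈ sumset Γ i, z = y + j * m) → 0 ≤ z := by
      rintro z (hz | ⟨i, j, y, hy, rfl⟩)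
      · linarith
      · have := H.sumset_nonneg hy
        positivity
    refine AddSubmonoid.closure_induction (motive := fun x _ =>
      c ≤ x ∨ ∃ i j : ℕ, ∃ y ∈ sumset Γ i, x = y + j * m) ?_ ?_ ?_ hx
    · rintro z ((hz | hz) | hz)
      · exact Or.inr ⟨0, 1, 0, rfl, by simpa using hz⟩
      · exact Or.inr ⟨1, 0, z, sumset_one_of_mem hz, by simp⟩
      · exact Or.inl hz
    · exact Or.inr ⟨0, 0, 0, rfl, by simp⟩
    · intro u v _ _ hu hv
      have hu0 := hnn u hu
      have hv0 := hnn v hv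
      rcases hu with hu | ⟨i, j, y, hy, rfl⟩
      · left; linarith
      · rcases hv with hv | ⟨i', j', y', hy', rfl⟩
        · left; linarith
        · exact Or.inr ⟨i + i', j + j', y + y', add_mem_sumset hy hy', by push_cast; ring⟩
  · rintro (hx | ⟨i, j, y, hy, rfl⟩)
    · exact AddSubmonoid.subset_closure (s := {m} ∪ (Γ : Set ℤ) ∪ Set.Ici c) (Or.inr hx)
    · obtain ⟨M, -, hM, rfl⟩ := mem_sumset_iff.1 hy
      refine AddSubmonoid.add_mem (AddSubmonoid.closure _) (AddSubmonoid.multiset_sum_mem _ _ fun g hg =>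
        gen_mem_SgpSet m c (hM g hg)) ?_
      rw [← nsmul_eq_mul]
      exact AddSubmonoid.nsmul_mem _ (mult_mem_SgpSet m c Γ) j

lemma nonneg_of_mem (H : IsRegularData h c m Γ) {x : ℤ} (hx : x ∈ SgpSet m Γ c) : 0 ≤ x := by
  have hm := H.pos
  have hc := H.lt_conductor
  rcases H.mem_SgpSet_iff.1 hx with h | ⟨i, j, y, hy, rfl⟩
  · linarith
  · have := H.sumset_nonneg hy
    positivity

lemma gen_lt_conductor (H : IsRegularData h c m Γ) {g : ℤ} (hg : g ∈ Γ) : g < c :=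
  H.sumset_lt_conductor (by have := H.two_le; omega) (sumset_one_of_mem hg)

/-- A sum of two nonzero elements of the semigroup is not primitive. -/
lemma not_isPrimitive_add (H : IsRegularData h c m Γ) {u v : ℤ} (hu : u ∈ SgpSet m Γ c) (hv : v ∈ SgpSet m Γ c)
    (hu0 : u ≠ 0) (hv0 : v ≠ 0) : ¬ IsPrimitive (SgpSet m Γ c) (u + v) := by
  rintro ⟨-, -, hp⟩
  have h1 := (H.nonneg_of_mem hu).lt_of_ne' hu0
  have h2 := (H.nonneg_of_mem hv).lt_of_ne' hv0
  exact hp ⟨u, v, hu, hv, hu0, hv0, by linarith, by linarith, rfl⟩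

/-- A primitive `λ + jm` with `λ ∈ iΓ` is `m` or lies in `Γ`. -/
lemma mem_gens_of_isPrimitive (H : IsRegularData h c m Γ) {i j : ℕ} {y : ℤ} (hy : y ∈ sumset Γ i)
    (hp : IsPrimitive (SgpSet m Γ c) (y + j * m)) : y + j * m = m ∨ y + j * m ∈ Γ := by
  have hm := H.pos
  rcases j with _ | j
  · rcases i with _ | i
    · simp only [sumset, Set.mem_singleton_iff] at hy
      subst hy
      simp [IsPrimitive] at hp
    · obtain ⟨g, hg, z, hz, rfl⟩ := hy
      by_cases hz0 : z = 0
      · right; simpa [hz0] using hg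
      · refine absurd hp ?_
        have hzS : z ∈ SgpSet m Γ c := H.mem_SgpSet_iff.2 (Or.inr ⟨i, 0, z, hz, by simp⟩)
        have := H.not_isPrimitive_add (gen_mem_SgpSet m c hg) hzS
          (hm.trans (H.lt_of_mem g hg)).ne' hz0
        simpa using this
  · by_cases hz0 : y + j * m = 0
    · left; push_cast; linarith
    · refine absurd hp ?_
      have hzS : y + j * m ∈ SgpSet m Γ c := H.mem_SgpSet_iff.2 (Or.inr ⟨i, j, y, hy, rfl⟩)
      have := H.not_isPrimitive_add hzS (mult_mem_SgpSet m c Γ) hz0 hm.ne'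
      rwa [show y + ((j + 1 : ℕ) : ℤ) * m = y + j * m + m by push_cast; ring]

lemma nLeftGen_eq (H : IsRegularData h c m Γ) (hpm : IsPrimitive (SgpSet m Γ c) m)
    (hpΓ : ∀ g ∈ Γ, IsPrimitive (SgpSet m Γ c) g) :
    nLeftGen (SgpSet m Γ c) c = Γ.card + 1 := by
  have hmΓ : m ∉ Γ := fun hmΓ => lt_irrefl _ (H.lt_of_mem m hmΓ)
  have : {x : ℤ | IsPrimitive (SgpSet m Γ c) x ∧ x < c} = ((insert m Γ : Finset ℤ) : Set ℤ) := by
    ext x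
    simp only [Set.mem_ofPred_eq, Finset.coe_insert, Set.mem_insert_iff, Finset.mem_coe]
    constructor
    · rintro ⟨hp, hx⟩
      rcases H.mem_SgpSet_iff.1 hp.1 with h | ⟨i, j, y, hy, rfl⟩
      · omega
      · exact H.mem_gens_of_isPrimitive hy hp
    · rintro (rfl | hx)
      · exact ⟨hpm, H.lt_conductor⟩
      · exact ⟨hpΓ x hx, H.gen_lt_conductor hx⟩
  rw [nLeftGen, this, Set.ncard_coe_finset, Finset.card_insert_of_notMem hmΓ]

end IsRegularData

/-! ### Ceiling counts -/

lemma ceilCount_spec {c m : ℤ} (hm : 0 < m) (x : ℤ) :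
    c ≤ x + ceilCount c m x * m ∧ x + ceilCount c m x * m < c + m := by
  have hm' : (0 : ℚ) < m := by exact_mod_cast hm
  have h1 := Int.le_ceil (((c - x : ℤ) : ℚ) / m)
  have h2 := Int.ceil_lt_add_one (((c - x : ℤ) : ℚ) / m)
  rw [div_le_iff₀ hm'] at h1
  rw [← sub_lt_iff_lt_add, lt_div_iff₀ hm'] at h2
  have h1' : c - x ≤ ⌈((c - x : ℤ) : ℚ) / m⌉ * m := by exact_mod_cast h1
  have h2' : (⌈((c - x : ℤ) : ℚ) / m⌉ - 1) * m < c - x := by exact_mod_cast h2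
  rw [ceilCount]
  constructor <;> linarith

lemma add_mul_lt_iff {c m : ℤ} (hm : 0 < m) (x j : ℤ) :
    x + j * m < c ↔ j < ceilCount c m x := by
  have hm' : (0 : ℚ) < m := by exact_mod_cast hm
  rw [ceilCount, Int.lt_ceil, lt_div_iff₀ hm']
  have : (j : ℚ) * m < ((c - x : ℤ) : ℚ) ↔ j * m < c - x := by exact_mod_cast Iff.rfl
  rw [this]
  constructor <;> intro h <;> linarith

lemma eq_ceilCount {c m : ℤ} (hm : 0 < m) {x j : ℤ} (h1 : c ≤ x + j * m)
    (h2 : x + j * m < c + m) : j = ceilCount c m x := by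
  apply le_antisymm
  · have := (add_mul_lt_iff (c := c) hm x (j - 1)).1 (by linarith)
    omega
  · have := mt (add_mul_lt_iff (c := c) hm x j).2 (not_lt.2 h1)
    omega

/-! ### Collision-free regular semigroups -/

/-- Regular data whose semigroup is collision-free with `m` and `Γ` primitive. -/
structure IsCollisionFreeData (h : ℕ) (c m : ℤ) (Γ : Finset ℤ) : Prop
    extends IsRegularData h c m Γ where
  mult_primitive : IsPrimitive (SgpSet m Γ c) m
  gen_primitive : ∀ g ∈ Γ, IsPrimitive (SgpSet m Γ c) g
  collisionFree : IsCollisionFree (SgpSet m Γ c) c m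

namespace IsCollisionFreeData

variable {h : ℕ} {c m : ℤ} {Γ : Finset ℤ}

/-- Sums of left generators below `c + m` determine their summands. -/
lemma multiset_eq (H : IsCollisionFreeData h c m Γ) {M N : Multiset ℤ} (hM : ∀ g ∈ M, g = m ∨ g ∈ Γ)
    (hN : ∀ g ∈ N, g = m ∨ g ∈ Γ) (hMN : M.sum = N.sum) (hlt : M.sum < c + m) : M = N := by
  obtain ⟨p, hp1, hp2⟩ : ∃ p : ℕ, c ≤ M.sum + p * m ∧ M.sum + p * m < c + m := by
    by_cases hc : c ≤ M.sum
    · exact ⟨0, by simpa using hc, by simpa using hlt⟩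
    · have h0 := (add_mul_lt_iff (c := c) H.pos M.sum 0).1 (by linarith)
      have hs := ceilCount_spec (c := c) H.pos M.sum
      refine ⟨(ceilCount c m M.sum).toNat, ?_⟩
      rwa [Int.toNat_of_nonneg h0.le]
  have hprim : ∀ K : Multiset ℤ, (∀ g ∈ K, g = m ∨ g ∈ Γ) →
      ∀ g ∈ K + Multiset.replicate p m, IsPrimitive (SgpSet m Γ c) g := by
    intro K hK g hg
    rcases Multiset.mem_add.1 hg with hg | hg
    · rcases hK g hg with rfl | hg
      exacts [H.mult_primitive, H.gen_primitive g hg]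
    · rw [Multiset.eq_of_mem_replicate hg]
      exact H.mult_primitive
  refine add_right_cancel (H.collisionFree (M.sum + p * m) (H.mem_SgpSet_iff.2 (Or.inl hp1)) hp1
    hp2 _ _ (hprim M hM) (hprim N hN) ?_ ?_)
  · simp
  · simp [hMN]

/-- Elements `λ + jm < c + m` determine `i`, `λ ∈ iΓ` and `j`. -/
lemma rep_unique (H : IsCollisionFreeData h c m Γ) {i i' j j' : ℕ} {y y' : ℤ} (hy : y ∈ sumset Γ i) (hy' : y' ∈ sumset Γ i')
    (heq : y + j * m = y' + j' * m) (hlt : y + j * m < c + m) : i = i' ∧ y = y' ∧ j = j' := by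
  have hmΓ : m ∉ Γ := fun hmΓ => lt_irrefl _ (H.lt_of_mem m hmΓ)
  obtain ⟨M, rfl, hM, rfl⟩ := mem_sumset_iff.1 hy
  obtain ⟨N, rfl, hN, rfl⟩ := mem_sumset_iff.1 hy'
  have hgen : ∀ (K : Multiset ℤ) (p : ℕ), (∀ g ∈ K, g ∈ Γ) →
      ∀ g ∈ K + Multiset.replicate p m, g = m ∨ g ∈ Γ := by
    intro K p hK g hg
    rcases Multiset.mem_add.1 hg with hg | hg
    exacts [Or.inr (hK g hg), Or.inl (Multiset.eq_of_mem_replicate hg)]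
  have key := H.multiset_eq (hgen M j hM) (hgen N j' hN) (by simpa using heq) (by simpa using hlt)
  have hcount : ∀ (K : Multiset ℤ) (p : ℕ), (∀ g ∈ K, g ∈ Γ) →
      (K + Multiset.replicate p m).count m = p := by
    intro K p hK
    simp [Multiset.count_eq_zero_of_notMem fun hmK => hmΓ (hK m hmK)]
  have hj : j = j' := by rw [← hcount M j hM, key, hcount N j' hN]
  subst hj
  have := add_right_cancel key
  subst this
  simp

lemma card_sumFinset (H : IsCollisionFreeData h c m Γ) {i : ℕ} (hi : i ≤ h) :
    (sumFinset Γ i).card = sNum (Γ.card + 1) i := by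
  rw [sumFinset, Finset.card_image_of_injOn, card_sym_eq_multichoose, Nat.multichoose_eq, sNum]
  · congr 1
    omega
  · intro M hM N hN hMN
    have hMs : (M : Multiset ℤ).sum ∈ sumset Γ i :=
      mem_sumFinset.1 (Finset.mem_image_of_mem _ hM)
    have hlt : (M : Multiset ℤ).sum < c + m := by
      rcases hi.lt_or_eq with hi | rfl
      · linarith [H.sumset_lt_conductor hi hMs, H.pos]
      · exact H.sumset_lt_conductor_add hMs
    refine Sym.coe_injective (H.multiset_eq (fun g hg => Or.inr ?_) (fun g hg => Or.inr ?_) hMN hlt)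
    · exact Finset.mem_sym_iff.1 hM g hg
    · exact Finset.mem_sym_iff.1 hN g hg

/-- The elements below `c`, counted by their `λ ∈ iΓ`. -/
lemma rank_eq (H : IsCollisionFreeData h c m Γ) : rank (SgpSet m Γ c) c
    = ∑ i ∈ Finset.range h, ∑ y ∈ sumFinset Γ i, (ceilCount c m y).toNat := by
  set D : Finset (Σ _ : ℕ, Σ _ : ℤ, ℕ) := (Finset.range h).sigma fun i =>
    (sumFinset Γ i).sigma fun y => Finset.range (ceilCount c m y).toNat with hD
  set f : (Σ _ : ℕ, Σ _ : ℤ, ℕ) → ℤ := fun p => p.2.1 + p.2.2 * m with hf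
  have hmem : ∀ i y j, (⟨i, y, j⟩ : Σ _ : ℕ, Σ _ : ℤ, ℕ) ∈ D ↔
      i < h ∧ y ∈ sumset Γ i ∧ y + (j : ℤ) * m < c := by
    intro i y j
    simp only [hD, Finset.mem_sigma, Finset.mem_range, mem_sumFinset, add_mul_lt_iff H.pos,
      Int.lt_toNat]
  have himg : SgpSet m Γ c ∩ Set.Iio c = ((D.image f : Finset ℤ) : Set ℤ) := by
    ext x
    simp only [Set.mem_inter_iff, Set.mem_Iio, Finset.coe_image, Set.mem_image, Finset.mem_coe]
    constructor
    · rintro ⟨hx, hxc⟩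
      rcases H.mem_SgpSet_iff.1 hx with h1 | ⟨i, j, y, hy, rfl⟩
      · omega
      · refine ⟨⟨i, y, j⟩, (hmem _ _ _).2 ⟨?_, hy, hxc⟩, rfl⟩
        by_contra hi
        have h1 := H.conductor_le_sumset (not_lt.1 hi) hy
        have h2 : (0 : ℤ) ≤ j * m := mul_nonneg (by positivity) H.pos.le
        linarith
    · rintro ⟨⟨i, y, j⟩, hp, rfl⟩
      obtain ⟨-, hy, hlt⟩ := (hmem _ _ _).1 hp
      exact ⟨H.mem_SgpSet_iff.2 (Or.inr ⟨i, j, y, hy, rfl⟩), hlt⟩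
  rw [rank, himg, Set.ncard_coe_finset, Finset.card_image_of_injOn, hD, Finset.card_sigma]
  · simp
  · rintro ⟨i, y, j⟩ hp ⟨i', y', j'⟩ hp' heq
    obtain ⟨-, hy, hlt⟩ := (hmem _ _ _).1 hp
    obtain ⟨-, hy', -⟩ := (hmem _ _ _).1 hp'
    obtain ⟨rfl, rfl, rfl⟩ := H.rep_unique hy hy' heq (by linarith [H.pos])
    rfl

lemma ceilCount_nonneg (H : IsCollisionFreeData h c m Γ) {i : ℕ} (hi : i ≤ h) {y : ℤ} (hy : y ∈ sumset Γ i) :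
    0 ≤ ceilCount c m y := by
  have : y < c + m := by
    rcases hi.lt_or_eq with hi | rfl
    · linarith [H.sumset_lt_conductor hi hy, H.pos]
    · exact H.sumset_lt_conductor_add hy
  have := (add_mul_lt_iff (c := c) H.pos y (-1)).1 (by linarith)
  omega

/-- The non-primitive elements of `[c, c+m)` correspond to the elements of the `iΓ`, `i ≤ h`. -/
lemma nRightGen_add (H : IsCollisionFreeData h c m Γ) : nRightGen (SgpSet m Γ c) c m + sTot (Γ.card + 1) h = m.toNat := by
  set D : Finset (Σ _ : ℕ, ℤ) := (Finset.range (h + 1)).sigma fun i => sumFinset Γ i with hD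
  set f : (Σ _ : ℕ, ℤ) → ℤ := fun p => p.2 + ceilCount c m p.2 * m with hf
  have hmem : ∀ i y, (⟨i, y⟩ : Σ _ : ℕ, ℤ) ∈ D ↔ i ≤ h ∧ y ∈ sumset Γ i := by
    intro i y
    simp only [hD, Finset.mem_sigma, Finset.mem_range, mem_sumFinset, Nat.lt_succ_iff]
  have hDcard : (D.image f).card = sTot (Γ.card + 1) h := by
    rw [Finset.card_image_of_injOn, hD, Finset.card_sigma,
      ← sum_sNum (by have := H.nonempty.card_pos; omega)]
    · refine Finset.sum_congr rfl fun i hi => H.card_sumFinset ?_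
      have := Finset.mem_range.1 hi
      omega
    · rintro ⟨i, y⟩ hp ⟨i', y'⟩ hp' heq
      obtain ⟨hi, hy⟩ := (hmem _ _).1 hp
      obtain ⟨hi', hy'⟩ := (hmem _ _).1 hp'
      have hlt := (ceilCount_spec (c := c) H.pos y).2
      obtain ⟨j, hj⟩ := Int.eq_ofNat_of_zero_le (H.ceilCount_nonneg hi hy)
      obtain ⟨j', hj'⟩ := Int.eq_ofNat_of_zero_le (H.ceilCount_nonneg hi' hy')
      simp only [hf, hj, hj'] at heq
      rw [hj] at hlt
      obtain ⟨rfl, rfl, -⟩ := H.rep_unique hy hy' heq hlt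
      rfl
  have hsub : D.image f ⊆ Finset.Ico c (c + m) := by
    intro x hx
    obtain ⟨⟨i, y⟩, -, rfl⟩ := Finset.mem_image.1 hx
    exact Finset.mem_Ico.2 (ceilCount_spec H.pos y)
  have hset : {x : ℤ | IsPrimitive (SgpSet m Γ c) x ∧ c ≤ x ∧ x < c + m}
      = ((Finset.Ico c (c + m) \ D.image f : Finset ℤ) : Set ℤ) := by
    ext x
    simp only [Set.mem_ofPred_eq, Finset.coe_sdiff, Set.mem_sdiff, Finset.mem_coe, Finset.mem_Ico]
    constructor
    · rintro ⟨hp, hx⟩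
      refine ⟨hx, fun hxD => ?_⟩
      obtain ⟨⟨i, y⟩, hiy, rfl⟩ := Finset.mem_image.1 hxD
      obtain ⟨hi, hy⟩ := (hmem _ _).1 hiy
      obtain ⟨j, hj⟩ := Int.eq_ofNat_of_zero_le (H.ceilCount_nonneg hi hy)
      simp only [hf, hj] at hp hx
      rcases H.mem_gens_of_isPrimitive hy hp with h1 | h1
      · linarith [H.lt_conductor, hx.1]
      · linarith [H.gen_lt_conductor h1, hx.1]
    · rintro ⟨hx, hxD⟩
      have hc := H.lt_conductor
      refine ⟨⟨H.mem_SgpSet_iff.2 (Or.inl hx.1), by linarith [H.pos], ?_⟩, hx⟩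
      rintro ⟨u, v, hu, hv, hu0, hv0, -, -, rfl⟩
      apply hxD
      have hge : ∀ z ∈ SgpSet m Γ c, z ≠ 0 → m ≤ z := by
        intro z hz hz0
        rcases H.mem_SgpSet_iff.1 hz with h1 | ⟨i, j, y, hy, rfl⟩
        · linarith
        · rcases j with _ | j
          · rcases i with _ | i
            · simp [sumset] at hy; simp [hy] at hz0
            · obtain ⟨g, hg, w, hw, rfl⟩ := hy
              have := H.sumset_nonneg hw
              have := H.lt_of_mem g hg
              push_cast
              linarith
          · have := H.sumset_nonneg hy
            have : (0 : ℤ) ≤ j * m := mul_nonneg (by positivity) H.pos.le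
            push_cast
            linarith
      have hum := hge u hu hu0
      have hvm := hge v hv hv0
      rcases H.mem_SgpSet_iff.1 hu with h1 | ⟨i, j, y, hy, rfl⟩
      · linarith
      rcases H.mem_SgpSet_iff.1 hv with h1 | ⟨i', j', y', hy', rfl⟩
      · linarith
      have hyy := add_mem_sumset hy hy'
      have heq : y + j * m + (y' + j' * m) = (y + y') + ((j + j' : ℕ) : ℤ) * m := by
        push_cast; ring
      rw [heq] at hx ⊢
      have hj0 : (0 : ℤ) ≤ ((j + j' : ℕ) : ℤ) * m := mul_nonneg (by positivity) H.pos.le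
      refine Finset.mem_image.2 ⟨⟨i + i', y + y'⟩, (hmem _ _).2 ⟨?_, hyy⟩, ?_⟩
      · by_contra hi
        linarith [H.conductor_add_lt_sumset (not_le.1 hi) hyy]
      · simp only [hf]
        rw [← eq_ceilCount H.pos hx.1 hx.2]
  rw [nRightGen, hset, Set.ncard_coe_finset, ← hDcard, Finset.card_sdiff_add_card_eq_card hsub,
    Int.card_Ico]
  congr 1
  ring

end IsCollisionFreeData

/-! ### Short and long elements -/

lemma IsRegularData.ceilCount_eq {h : ℕ} {c m : ℤ} {Γ : Finset ℤ} (H : IsRegularData h c m Γ)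
    {a b a' b' : ℤ} (hF : IsFareyPred h a b a' b')
    (h1 : (a' : ℚ) / b' < ((c + m : ℤ) : ℚ) / (h * m))
    (h2 : ((c + m : ℤ) : ℚ) / (h * m) ≤ (a : ℚ) / b) {i : ℕ} (hi : i < h) {y : ℤ}
    (hy : y ∈ sumset Γ i) :
    ⌊((h - i : ℕ) : ℚ) * (a' / b')⌋ ≤ ceilCount c m y ∧
      ceilCount c m y ≤ ⌊((h - i : ℕ) : ℚ) * (a' / b')⌋ + 1 ∧
      (i = 0 → ceilCount c m y = ⌊((h - i : ℕ) : ℚ) * (a' / b')⌋) := by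
  set θ : ℚ := ((c + m : ℤ) : ℚ) / (h * m) with hθ
  have hm : (0 : ℚ) < m := by exact_mod_cast H.pos
  have hh : (0 : ℚ) < h := by exact_mod_cast H.cast_pos
  have hθe : θ * (h * m) = c + m := by
    rw [hθ, div_mul_cancel₀ _ (by positivity)]; push_cast; rfl
  have hceil := ceil_mul_eq_floor_add_one hF h1 h2 (i := h - i) (by omega) (by omega)
  rw [mul_div_assoc] at hceil
  set B := ⌊((h - i : ℕ) : ℚ) * (a' / b')⌋ with hB
  have hcast : ((h - i : ℕ) : ℚ) = h - i := Nat.cast_sub hi.le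
  have hub := Int.le_ceil (((h - i : ℕ) : ℚ) * θ)
  have hlb := Int.ceil_lt_add_one (((h - i : ℕ) : ℚ) * θ)
  rw [hceil, hcast] at hub hlb
  push_cast at hub hlb
  obtain ⟨hb1, hb2⟩ := sumset_bounds H.le_mul H.mul_le hy
  have hb1' : (i : ℚ) * c ≤ h * y := by exact_mod_cast hb1
  have hb2' : (h : ℚ) * y ≤ i * (c + m - 1) := by exact_mod_cast hb2
  have hi0 : (0 : ℚ) ≤ i := by positivity
  have hih : (i : ℚ) < h := by exact_mod_cast hi
  have hscale : ∀ z : ℚ, (h : ℚ) * (z * m) - (h * (c - y)) = h * m * (z + 1 - (h - i) * θ)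
      - (i * (c + m) - h * y) := by
    intro z
    linear_combination ((h : ℚ) - i) * hθe
  have hle : ceilCount c m y ≤ B + 1 := by
    rw [ceilCount, Int.ceil_le, div_le_iff₀ hm]
    push_cast
    have := hscale (B + 1)
    have h3 : 0 ≤ (h : ℚ) * m * (B + 1 - (h - i) * θ) := by
      apply mul_nonneg (by positivity); linarith
    have h4 : (i : ℚ) * m ≤ h * m := mul_le_mul_of_nonneg_right hih.le hm.le
    have : (h : ℚ) * (c - y) ≤ h * ((B + 1) * m) := by nlinarith
    exact le_of_mul_le_mul_left this hh
  have hge : B ≤ ceilCount c m y := by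
    rw [← Int.sub_one_lt_iff, ceilCount, Int.lt_ceil, lt_div_iff₀ hm]
    push_cast
    have := hscale (B - 1)
    have h3 : 0 < (h : ℚ) * m * ((h - i) * θ - B) := by
      apply mul_pos (by positivity); linarith
    have : (h : ℚ) * ((B - 1) * m) < h * (c - y) := by nlinarith
    exact lt_of_mul_lt_mul_left this hh.le
  refine ⟨hge, hle, ?_⟩
  rintro rfl
  refine le_antisymm ?_ hge
  simp only [sumset, Set.mem_singleton_iff] at hy
  subst hy
  rw [ceilCount, Int.ceil_le, div_le_iff₀ hm]
  have := hscale B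
  have h3 : 0 ≤ (h : ℚ) * m * (B + 1 - (h - (0 : ℕ)) * θ) := by
    apply mul_nonneg (by positivity); linarith
  push_cast at *
  have : (h : ℚ) * (c - 0) ≤ h * (B * m) := by linarith
  exact le_of_mul_le_mul_left this hh

end Eliahou

namespace Eliahou

/-- The rank in terms of the counts `s_i` and the number of long elements. -/
lemma IsCollisionFreeData.rank_eq_sum_add {h : ℕ} {c m : ℤ} {Γ : Finset ℤ}
    (H : IsCollisionFreeData h c m Γ) {B : ℕ → ℤ}
    (hB : ∀ i < h, ∀ y ∈ sumset Γ i, B i ≤ ceilCount c m y ∧ ceilCount c m y ≤ B i + 1) :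
    (rank (SgpSet m Γ c) c : ℤ) = ∑ i ∈ Finset.range h, B i * sNum (Γ.card + 1) i
      + ((∑ i ∈ Finset.range h,
          {y ∈ sumset Γ i | ceilCount c m y = B i + 1}.ncard : ℕ) : ℤ) := by
  rw [H.rank_eq, Nat.cast_sum, Nat.cast_sum, ← Finset.sum_add_distrib]
  refine Finset.sum_congr rfl fun i hi => ?_
  have hi' := Finset.mem_range.1 hi
  have hset : {y ∈ sumset Γ i | ceilCount c m y = B i + 1}
      = (((sumFinset Γ i).filter fun y => ceilCount c m y = B i + 1 : Finset ℤ) : Set ℤ) := by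
    ext y
    simp [mem_sumFinset]
  rw [hset, Set.ncard_coe_finset, Finset.card_filter, Nat.cast_sum, Nat.cast_sum,
    ← H.card_sumFinset hi'.le, mul_comm, ← nsmul_eq_mul, ← Finset.sum_const,
    ← Finset.sum_add_distrib]
  refine Finset.sum_congr rfl fun y hy => ?_
  have hy' := mem_sumFinset.1 hy
  have h0 := H.ceilCount_nonneg hi'.le hy'
  have h1 := hB i hi' y hy'
  rw [Int.toNat_of_nonneg h0]
  split_ifs with h2
  · simpa using h2
  · push_cast
    omega

lemma isRegularData_Sgam {h : ℕ} (hh : 2 ≤ h) {a b : ℤ} {Δ : Finset ℕ} (hΔ : Δ.Nonempty)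
    {τ m : ℤ} (hmult : IsMultiplicity h a b τ m Δ) (hreg : Sw h a b τ m Δ ≤ m) :
    IsRegularData h (Sc h a b τ m) m (Sgam h a b τ m Δ) := by
  have hh0 : (0 : ℤ) < h := by omega
  have hbase : (h : ℤ) * Sbase h a b τ m ≤ Sc h a b τ m + m - 1 := by
    have h1 := Int.floor_le (((Sc h a b τ m + m - 1 : ℤ) : ℚ) / (h : ℚ))
    rw [le_div_iff₀ (by exact_mod_cast hh0)] at h1
    have h2 : ⌊((Sc h a b τ m + m - 1 : ℤ) : ℚ) / (h : ℚ)⌋ * h ≤ Sc h a b τ m + m - 1 := by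
      exact_mod_cast h1
    rw [mul_comm]
    exact h2
  rw [Sw, gamma1, mul_sub] at hreg
  refine ⟨hh, hΔ.image _, ?_, hmult, ?_, ?_⟩
  · have : (0 : ℤ) ≤ h * delta1 Δ := by positivity
    linarith
  · intro g hg
    obtain ⟨δ, hδ, rfl⟩ := Finset.mem_image.1 hg
    have h1 : (δ : ℤ) ≤ delta1 Δ := by exact_mod_cast Finset.le_sup (f := id) hδ
    have h2 := mul_le_mul_of_nonneg_left h1 hh0.le
    rw [mul_sub]
    linarith
  · intro g hg
    obtain ⟨δ, hδ, rfl⟩ := Finset.mem_image.1 hg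
    have : (0 : ℤ) ≤ h * δ := by positivity
    rw [mul_sub]
    linarith

/-- The conditions `t ≥ 0` and `m > bb't/h` place `(c+m)/(hm)` in the Farey interval. -/
lemma mem_farey_interval {h : ℕ} (hh : 0 < h) {a b a' b' : ℤ} (hF : IsFareyPred h a b a' b')
    {τ m : ℤ} (hm : 0 < m) (ht : 0 ≤ St h a b τ m)
    (hint : (b : ℚ) * (b' : ℚ) * St h a b τ m / (h : ℚ) < (m : ℚ)) :
    (a' : ℚ) / b' < ((Sc h a b τ m + m : ℤ) : ℚ) / (h * m) ∧
      ((Sc h a b τ m + m : ℤ) : ℚ) / (h * m) ≤ (a : ℚ) / b := by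
  obtain ⟨⟨hb, -, -⟩, ⟨hb', -, -⟩, hlt, -⟩ := hF
  have hbq : (0 : ℚ) < b := by exact_mod_cast hb
  have hbq' : (0 : ℚ) < b' := by exact_mod_cast hb'
  have hhq : (0 : ℚ) < h := by exact_mod_cast hh
  have hmq : (0 : ℚ) < m := by exact_mod_cast hm
  have hdet : (a' : ℚ) * b + 1 ≤ a * b' := by
    rw [div_lt_div_iff₀ hbq' hbq] at hlt
    have : a' * b < a * b' := by exact_mod_cast hlt
    exact_mod_cast this
  rw [St] at ht hint
  push_cast
  constructor
  · rw [div_lt_iff₀ hhq] at hint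
    rw [div_lt_div_iff₀ hbq' (by positivity)]
    have hexp : (b : ℚ) * b' * (a * h * m / b - Sc h a b τ m - m)
        = a * b' * (h * m) - b * (b' * (Sc h a b τ m + m)) := by
      field_simp
      ring
    rw [hexp] at hint
    have h3 := mul_le_mul_of_nonneg_right hdet (by positivity : (0 : ℚ) ≤ h * m)
    have : (b : ℚ) * (a' * (h * m)) < b * ((Sc h a b τ m + m) * b') := by nlinarith
    exact lt_of_mul_lt_mul_left this hbq.le
  · rw [div_le_div_iff₀ (by positivity) hbq]
    have : (Sc h a b τ m + m : ℚ) ≤ a * h * m / b := by linarith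
    rw [le_div_iff₀ hbq] at this
    linarith

end Eliahou

/-- If `S = S(h, a/b, Δ, τ, m)` has multiplicity `m`, is `h`-regular (`m ≥ w`), has
`(c+m)/(hm)` in the Farey interval `(a'/b', a/b]` (`t ≥ 0` and `m > bb't/h`), is
canonically defined and collision-free, then `E = E₀ + ρ + ℓω`, and `E₀` has three
further equivalent forms. -/
theorem eliahou_number_formula (h : ℕ) (hh : 2 ≤ h) (a b a' b' : ℤ)
    (hF : IsFareyPred h a b a' b') (Δ : Finset ℕ) (hΔ : Δ.Nonempty) (τ m : ℤ)
    (hmult : IsMultiplicity h a b τ m Δ)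
    (hreg : Sw h a b τ m Δ ≤ m)
    (ht : 0 ≤ St h a b τ m)
    (hint : (b : ℚ) * (b' : ℚ) * St h a b τ m / (h : ℚ) < (m : ℚ))
    (hcan : IsCanonical h a b τ m Δ)
    (hcf : IsCollisionFree (Sset h a b τ m Δ) (Sc h a b τ m) m) :
    ((EliahouNum (Sset h a b τ m Δ) (Sc h a b τ m) m : ℤ) : ℚ)
        = E0 h a' b' (nLeftGen (Sset h a b τ m Δ) (Sc h a b τ m))
          + ((rho (Sc h a b τ m) m : ℤ) : ℚ)
          + (nLeftGen (Sset h a b τ m Δ) (Sc h a b τ m) : ℚ)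
            * (nLong h a b a' b' τ m Δ : ℚ) ∧
      E0 h a' b' (nLeftGen (Sset h a b τ m Δ) (Sc h a b τ m))
        = E0phi h a b (nLeftGen (Sset h a b τ m Δ) (Sc h a b τ m)) ∧
      E0 h a' b' (nLeftGen (Sset h a b τ m Δ) (Sc h a b τ m))
        = E0jump' h a' b' (nLeftGen (Sset h a b τ m Δ) (Sc h a b τ m)) ∧
      E0 h a' b' (nLeftGen (Sset h a b τ m Δ) (Sc h a b τ m))
        = E0jump h a b (nLeftGen (Sset h a b τ m Δ) (Sc h a b τ m)) := by
  have hR := isRegularData_Sgam hh hΔ hmult hreg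
  have H : IsCollisionFreeData h (Sc h a b τ m) m (Sgam h a b τ m Δ) :=
    ⟨hR, hcan.1, hcan.2.1, hcf⟩
  obtain ⟨h1, h2⟩ := mem_farey_interval (by omega) hF H.pos ht hint
  have hleft : nLeftGen (Sset h a b τ m Δ) (Sc h a b τ m) = (Sgam h a b τ m Δ).card + 1 :=
    hR.nLeftGen_eq hcan.1 hcan.2.1
  have hl : 2 ≤ (Sgam h a b τ m Δ).card + 1 := by have := H.nonempty.card_pos; omega
  have hshort : ∀ i < h, shortBound h a' b' i = ⌊((h - i : ℕ) : ℚ) * (a' / b')⌋ := by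
    intro i hi
    rw [shortBound, Nat.cast_sub hi.le, mul_div_assoc]
  rw [hleft]
  refine ⟨?_, E0_eq_E0phi hl (by omega) hF, E0_eq_E0jump' hl h a' b',
    (E0_eq_E0phi hl (by omega) hF).trans (E0phi_eq_E0jump hl h a b)⟩
  have hrank := H.rank_eq_sum_add (B := shortBound h a' b') (by
    intro i hi y hy
    have := hR.ceilCount_eq hF h1 h2 hi hy
    rw [hshort i hi]
    exact ⟨this.1, this.2.1⟩)
  have hq : qdepth (Sc h a b τ m) m = ⌊(h : ℚ) * (a' / b')⌋ := by
    have := (hR.ceilCount_eq hF h1 h2 (i := 0) (by omega) (y := 0) rfl).2.2 rfl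
    simpa [ceilCount, qdepth] using this
  have hright : (nRightGen (Sset h a b τ m Δ) (Sc h a b τ m) m : ℤ)
      + sTot ((Sgam h a b τ m Δ).card + 1) h = m := by
    have := H.nRightGen_add
    have hm := H.pos
    simp only [Sset]
    omega
  have hrank' : (rank (Sset h a b τ m Δ) (Sc h a b τ m) : ℤ)
      = ∑ i ∈ Finset.range h, ⌊((h - i : ℕ) : ℚ) * (a' / b')⌋
          * sNum ((Sgam h a b τ m Δ).card + 1) i + nLong h a b a' b' τ m Δ := by
    refine hrank.trans (congrArg₂ _ ?_ rfl)
    exact Finset.sum_congr rfl fun i hi => by rw [hshort i (Finset.mem_range.1 hi)]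
  have hrankQ := congrArg (Int.cast : ℤ → ℚ) hrank'
  have hrightQ := congrArg (Int.cast : ℤ → ℚ) hright
  rw [E0_eq_floor hl, EliahouNum, rho, hleft, hq]
  push_cast at hrankQ hrightQ ⊢
  rw [hrankQ, ← hrightQ]
  ring
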